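/- Let Z_l = √l · h_{l;2} where h_{l;2} = ∫_{S²}(f_l(x)²-1)dx and f_l is the centered isotropic Gaussian field on S² with covariance P_l(⟨x,y⟩). Then E[Z_l²] = 2l(4π)²/(2l+1), and Z_l/(4π) converges in distribution to a standard Gaussian as l → ∞, since cum₄(Z_l)/Var(Z_l)² = 12/(2l+1) → 0 and Z_l lives in the second Wiener chaos (fourth-moment theorem). -/

import Mathlib

open MeasureTheory ProbabilityTheory Polynomial Real Filter

noncomputable def legendreP (l : ℕ) : Polynomial ℝ :=
  Polynomial.C (1 / (2 ^ l * (Nat.factorial l) : ℝ)) *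
    (⇑Polynomial.derivative)^[l] ((Polynomial.X ^ 2 - 1) ^ l)

abbrev E3 := EuclideanSpace ℝ (Fin 3)
abbrev S2 := Metric.sphere (0 : E3) 1

namespace LegendreCLT

/-- Integration of polynomials over `[-1, 1]`, as a linear functional. -/
noncomputable def polyInt : ℝ[X] →ₗ[ℝ] ℝ where
  toFun p := ∫ t in (-1 : ℝ)..1, p.eval t
  map_add' p q := by
    simp only [eval_add]
    exact intervalIntegral.integral_add (p.continuous.intervalIntegrable _ _)
      (q.continuous.intervalIntegrable _ _)
  map_smul' c p := by simp

lemma polyInt_derivative (p : ℝ[X]) : polyInt (derivative p) = p.eval 1 - p.eval (-1) :=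
  intervalIntegral.integral_eq_sub_of_hasDerivAt (fun t _ => p.hasDerivAt t)
    ((derivative p).continuous.intervalIntegrable _ _)

lemma eq_zero_of_polyInt_mul_self {p : ℝ[X]} (h : polyInt (p * p) = 0) : p = 0 := by
  by_contra hp
  have hfin : (p.rootSet ℝ).Finite := p.rootSet_finite ℝ
  obtain ⟨c, hc, hpc⟩ : ∃ c ∈ Set.Icc (-1 : ℝ) 1, p.eval c ≠ 0 := by
    by_contra! hcon
    exact hp (p.eq_zero_of_infinite_isRoot
      ((Set.Icc_infinite (by norm_num : (-1 : ℝ) < 1)).mono fun x hx => hcon x hx))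
  have := intervalIntegral.integral_pos (a := -1) (b := 1) (f := fun t => (p * p).eval t)
    (by norm_num) (p * p).continuous.continuousOn
    (fun x _ => by simpa using mul_self_nonneg (p.eval x))
    ⟨c, hc, by simpa using mul_self_pos.mpr hpc⟩
  exact this.ne' h

lemma eval_iterate_derivative_X_sub_C_pow_mul (a : ℝ) (l : ℕ) (g : ℝ[X]) :
    (derivative^[l] ((X - C a) ^ l * g)).eval a = l.factorial * g.eval a := by
  have h : derivative^[l] ((X - C a) ^ l * g)
      = l.factorial • hasseDeriv l ((X - C a) ^ l * g) := by
    rw [← factorial_smul_hasseDeriv]; rfl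
  rw [h, eval_smul, ← taylor_coeff, taylor_mul, taylor_pow]
  simp [coeff_X_pow_mul']

lemma legendreP_eval_one (l : ℕ) : (legendreP l).eval 1 = 1 := by
  have h : ((X : ℝ[X]) ^ 2 - 1) ^ l = (X - C 1) ^ l * (X + 1) ^ l := by
    rw [← mul_pow]; congr 1; simp; ring
  rw [legendreP, eval_mul, h, eval_iterate_derivative_X_sub_C_pow_mul]
  have : (l.factorial : ℝ) ≠ 0 := by positivity
  simp
  field_simp
  norm_num

lemma legendreP_eval_neg_one_sq (l : ℕ) : (legendreP l).eval (-1) ^ 2 = 1 := by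
  have h : ((X : ℝ[X]) ^ 2 - 1) ^ l = (X - C (-1)) ^ l * (X - 1) ^ l := by
    rw [← mul_pow]; congr 1; simp; ring
  rw [legendreP, eval_mul, h, eval_iterate_derivative_X_sub_C_pow_mul]
  have : (l.factorial : ℝ) ≠ 0 := by positivity
  simp
  field_simp
  rw [show (-1 - 1 : ℝ) = -2 by norm_num, neg_pow]
  rcases neg_one_pow_eq_or ℝ l with h | h <;> simp [h]

lemma natDegree_legendreP_le (l : ℕ) : (legendreP l).natDegree ≤ l := by
  refine (natDegree_C_mul_le _ _).trans ((natDegree_iterate_derivative _ _).trans ?_)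
  have : ((X ^ 2 - 1 : ℝ[X]) ^ l).natDegree ≤ l * 2 := by
    refine natDegree_pow_le_of_le l ?_
    compute_degree
  omega

lemma degree_derivative_lt_of_degree_lt_succ {q : ℝ[X]} {k : ℕ} (h : q.degree < (k + 1 : ℕ)) :
    (derivative q).degree < k := by
  rw [degree_lt_iff_coeff_zero] at h ⊢
  intro m hm
  rw [coeff_derivative, h (m + 1) (by omega), zero_mul]

lemma polyInt_iterate_derivative_mul (l k : ℕ) (hk : k ≤ l) (q : ℝ[X]) (hq : q.degree < k) :
    polyInt (derivative^[k] ((X ^ 2 - 1) ^ l) * q) = 0 := by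
  induction k generalizing q with
  | zero =>
    have : q = 0 := by
      rw [← degree_eq_bot]
      exact Nat.WithBot.lt_zero_iff.mp (by simpa using hq)
    simp [this]
  | succ k ih =>
    have hdvd : (X ^ 2 - 1 : ℝ[X]) ∣ derivative^[k] ((X ^ 2 - 1) ^ l) :=
      (dvd_pow_self _ (by omega : l - k ≠ 0)).trans (pow_sub_dvd_iterate_derivative_pow _ l k)
    obtain ⟨r, hr⟩ := hdvd
    have h := polyInt_derivative (derivative^[k] ((X ^ 2 - 1) ^ l) * q)
    rw [derivative_mul, map_add, ih (by omega) _ (degree_derivative_lt_of_degree_lt_succ hq),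
      add_zero] at h
    rw [Function.iterate_succ_apply', h, hr]
    simp

lemma polyInt_legendreP_mul (l : ℕ) (q : ℝ[X]) (hq : q.degree < l) :
    polyInt (legendreP l * q) = 0 := by
  rw [legendreP, mul_assoc, C_mul', map_smul, polyInt_iterate_derivative_mul l l le_rfl q hq,
    smul_zero]

lemma degree_lt_of_natDegree_le_of_coeff {p : ℝ[X]} {l : ℕ} (h : p.natDegree ≤ l)
    (hc : p.coeff l = 0) : p.degree < l := by
  rw [degree_lt_iff_coeff_zero]
  intro m hm
  rcases hm.eq_or_lt with rfl | hm
  · exact hc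
  · exact coeff_eq_zero_of_natDegree_lt (by omega)

lemma polyInt_legendreP_mul_self (l : ℕ) :
    polyInt (legendreP l * legendreP l) = 2 / (2 * l + 1) := by
  set P := legendreP l with hP
  have hdeg : (X * derivative P - C (l : ℝ) * P).degree < (l : WithBot ℕ) := by
    refine degree_lt_of_natDegree_le_of_coeff ?_ ?_
    · have h1 : P.natDegree ≤ l := natDegree_legendreP_le l
      refine (natDegree_sub_le_of_le ?_ ((natDegree_C_mul_le _ _).trans h1)).trans
        (max_self l).le
      rcases Nat.eq_zero_or_pos l with rfl | hl
      · have : derivative P = 0 := by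
          rw [eq_C_of_natDegree_le_zero (p := P) h1]; simp
        simp [this]
      · have := natDegree_derivative_le P
        refine natDegree_mul_le.trans ?_
        simp only [natDegree_X]
        omega
    · rcases l with _ | l
      · simp
      · rw [coeff_sub, coeff_X_mul, coeff_derivative, coeff_C_mul]
        push_cast
        ring
  have h0 := polyInt_legendreP_mul l _ hdeg
  have h1 := polyInt_derivative (X * (P * P))
  have e1 : derivative (X * (P * P)) = P * P + (2 : ℝ) • (P * (X * derivative P)) := by
    rw [smul_eq_C_mul, show (C (2 : ℝ) : ℝ[X]) = 2 from rfl]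
    simp only [derivative_mul, derivative_X]
    ring
  have e2 : P * (X * derivative P - C (l : ℝ) * P)
      = P * (X * derivative P) - (l : ℝ) • (P * P) := by
    rw [smul_eq_C_mul]
    ring
  rw [e1, map_add, map_smul] at h1
  rw [← hP, e2, map_sub, map_smul] at h0
  have v1 := legendreP_eval_one l
  have v2 := legendreP_eval_neg_one_sq l
  simp only [← hP] at v1 v2
  simp only [eval_mul, eval_X, v1, smul_eq_mul] at h0 h1
  rw [eq_div_iff (by positivity)]
  linear_combination h1 - 2 * h0 + v2

lemma eq_C_mul_legendreP {l : ℕ} {s : ℝ[X]} (hs : s.natDegree ≤ l)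
    (h : ∀ q : ℝ[X], q.degree < l → polyInt (s * q) = 0) :
    s = C (s.eval 1) * legendreP l := by
  have hlead : (legendreP l).coeff l ≠ 0 := fun h0 => by
    have := eq_zero_of_polyInt_mul_self (polyInt_legendreP_mul l _
      (degree_lt_of_natDegree_le_of_coeff (natDegree_legendreP_le l) h0))
    simpa [this] using legendreP_eval_one l
  obtain ⟨c, hc⟩ : ∃ c : ℝ, c = s.coeff l / (legendreP l).coeff l := ⟨_, rfl⟩
  have hdeg : (s - C c * legendreP l).degree < l := by
    refine degree_lt_of_natDegree_le_of_coeff ?_ ?_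
    · exact (natDegree_sub_le_of_le hs ((natDegree_C_mul_le _ _).trans (natDegree_legendreP_le l))).trans
        (max_self l).le
    · simp [hc, hlead]
  have h0 : s - C c * legendreP l = 0 := by
    refine eq_zero_of_polyInt_mul_self ?_
    nth_rewrite 1 [sub_eq_add_neg]
    rw [add_mul, map_add, h _ hdeg, neg_mul, map_neg, mul_assoc, C_mul', map_smul,
      polyInt_legendreP_mul l _ hdeg]
    simp
  have hsc := sub_eq_zero.mp h0
  have : s.eval 1 = c := by rw [hsc]; simp [legendreP_eval_one]
  rw [this, ← hsc]

lemma integrable_of_continuous {S : Type*} [TopologicalSpace S] [CompactSpace S]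
    [MeasurableSpace S] [OpensMeasurableSpace S] {μ : Measure S} [IsFiniteMeasure μ]
    {g : S → ℝ} (hg : Continuous g) : Integrable g μ :=
  hg.integrable_of_hasCompactSupport (HasCompactSupport.of_compactSpace g)

section Sphere

variable {μ : Measure S2}

lemma integral_inner_pow_eq_of_norm_eq
    (hinv : ∀ (R : E3 ≃ₗᵢ[ℝ] E3) (g : E3 → ℝ), Continuous g →
      ∫ y : S2, g (R y) ∂μ = ∫ y : S2, g y ∂μ)
    (n : ℕ) {x z : E3} (h : ‖x‖ = ‖z‖) :
    ∫ y : S2, inner ℝ x (y : E3) ^ n ∂μ = ∫ y : S2, inner ℝ z (y : E3) ^ n ∂μ := by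
  have hR := Submodule.reflection_sub h
  set R : E3 ≃ₗᵢ[ℝ] E3 := (ℝ ∙ (x - z))ᗮ.reflection
  rw [← hinv R (fun y => inner ℝ z y ^ n) (by fun_prop)]
  simp only [← hR, R.inner_map_map]

lemma integral_inner_pow_of_odd
    (hinv : ∀ (R : E3 ≃ₗᵢ[ℝ] E3) (g : E3 → ℝ), Continuous g →
      ∫ y : S2, g (R y) ∂μ = ∫ y : S2, g y ∂μ)
    {a b : ℕ} (hab : Odd (a + b)) (x z : E3) :
    ∫ y : S2, inner ℝ x (y : E3) ^ a * inner ℝ z (y : E3) ^ b ∂μ = 0 := by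
  have h := hinv (LinearIsometryEquiv.neg ℝ) (fun y => inner ℝ x y ^ a * inner ℝ z y ^ b)
    (by fun_prop)
  have e : ∀ y : S2, inner ℝ x (LinearIsometryEquiv.neg ℝ (y : E3)) ^ a
      * inner ℝ z (LinearIsometryEquiv.neg ℝ (y : E3)) ^ b
      = -(inner ℝ x (y : E3) ^ a * inner ℝ z (y : E3) ^ b) := by
    intro y
    simp only [LinearIsometryEquiv.coe_neg, inner_neg_right]
    rw [neg_pow, neg_pow (inner ℝ z (y : E3)), mul_mul_mul_comm, ← pow_add, hab.neg_one_pow]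
    ring
  simp only [e, integral_neg] at h
  linarith

/-- The moments of the first coordinate under a measure on the sphere. -/
noncomputable def sphereMoment (μ : Measure S2) (n : ℕ) : ℝ :=
  ∫ y : S2, inner ℝ (EuclideanSpace.single (0 : Fin 3) (1 : ℝ)) (y : E3) ^ n ∂μ

lemma integral_inner_pow_eq
    (hinv : ∀ (R : E3 ≃ₗᵢ[ℝ] E3) (g : E3 → ℝ), Continuous g →
      ∫ y : S2, g (R y) ∂μ = ∫ y : S2, g y ∂μ)
    (n : ℕ) (v : E3) :
    ∫ y : S2, inner ℝ v (y : E3) ^ n ∂μ = sphereMoment μ n * ‖v‖ ^ n := by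
  rw [integral_inner_pow_eq_of_norm_eq hinv n
    (z := ‖v‖ • EuclideanSpace.single (0 : Fin 3) (1 : ℝ)) (by simp [norm_smul])]
  simp only [real_inner_smul_left, mul_pow, integral_const_mul]
  rw [sphereMoment, mul_comm]

/-- The bivariate polynomial `1 + 2 T S + S ^ 2`, as a polynomial in `S` over `ℝ[T]`. -/
noncomputable def quadBivar : ℝ[X][X] := 1 + C (C 2 * X) * X + X ^ 2

lemma natDegree_coeff_quadBivar_pow (k b : ℕ) : ((quadBivar ^ k).coeff b).natDegree ≤ b := by
  induction k generalizing b with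
  | zero =>
    rw [pow_zero, coeff_one]
    split_ifs <;> simp
  | succ k ih =>
    have h1 : ∀ j, (quadBivar.coeff j).natDegree ≤ j := by
      intro j
      rcases j with _ | _ | _ | j
      · simp [quadBivar]
      · simp [quadBivar, coeff_one, coeff_X_pow]
      · simp [quadBivar, coeff_one]
      · simp [quadBivar, coeff_one, coeff_X_pow]
    rw [pow_succ, coeff_mul]
    refine natDegree_sum_le_of_forall_le _ _ fun ij hij => ?_
    rw [← Finset.HasAntidiagonal.mem_antidiagonal.mp hij]
    exact natDegree_mul_le_of_le (ih _) (h1 _)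

variable [IsFiniteMeasure μ]

lemma integral_inner_pow_mul_inner_pow
    (hinv : ∀ (R : E3 ≃ₗᵢ[ℝ] E3) (g : E3 → ℝ), Continuous g →
      ∫ y : S2, g (R y) ∂μ = ∫ y : S2, g y ∂μ)
    (k b : ℕ) (hb : b ≤ 2 * k) (x z : S2) :
    ((2 * k).choose b : ℝ)
        * ∫ y : S2, inner ℝ (x : E3) (y : E3) ^ (2 * k - b) * inner ℝ (z : E3) (y : E3) ^ b ∂μ
      = sphereMoment μ (2 * k) * ((quadBivar ^ k).coeff b).eval (inner ℝ (x : E3) (z : E3)) := by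
  set t : ℝ := inner ℝ (x : E3) (z : E3) with ht
  set c : ℕ → ℝ := fun b => ((2 * k).choose b : ℝ)
    * ∫ y : S2, inner ℝ (x : E3) (y : E3) ^ (2 * k - b) * inner ℝ (z : E3) (y : E3) ^ b ∂μ with hc
  have key : ∑ j ∈ Finset.range (2 * k + 1), C (c j) * X ^ j
      = C (sphereMoment μ (2 * k)) * (quadBivar ^ k).map (evalRingHom t) := by
    refine Polynomial.funext fun s => ?_
    have h := integral_inner_pow_eq hinv (2 * k) (s • (z : E3) + x)
    have hn : ‖s • (z : E3) + x‖ ^ 2 = 1 + 2 * t * s + s ^ 2 := by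
      rw [norm_add_sq_real, norm_smul, real_inner_smul_left, real_inner_comm, ← ht]
      simp only [norm_eq_of_mem_sphere, Real.norm_eq_abs, mul_one, sq_abs]
      ring
    rw [pow_mul ‖_‖, hn] at h
    have hrhs : eval s (C (sphereMoment μ (2 * k)) * (quadBivar ^ k).map (evalRingHom t))
        = sphereMoment μ (2 * k) * (1 + 2 * t * s + s ^ 2) ^ k := by
      simp [quadBivar]
    rw [hrhs, ← h, eval_finsetSum]
    simp only [inner_add_left, real_inner_smul_left, add_pow]
    rw [integral_finsetSum _ fun i _ => integrable_of_continuous (by fun_prop)]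
    refine Finset.sum_congr rfl fun j _ => ?_
    simp only [hc, eval_mul, eval_C, eval_pow, eval_X]
    rw [mul_right_comm, ← integral_const_mul]
    refine integral_congr_ae (Eventually.of_forall fun y => ?_)
    simp only [mul_pow]
    ring
  have h := congrArg (fun p => coeff p b) key
  simpa only [finsetSum_coeff, coeff_C_mul, coeff_X_pow, mul_ite, mul_one, mul_zero,
    Finset.sum_ite_eq, Finset.mem_range, Nat.lt_succ_of_le hb, if_true, coeff_map,
    coe_evalRingHom] using h

lemma sphereMoment_succ
    (hinv : ∀ (R : E3 ≃ₗᵢ[ℝ] E3) (g : E3 → ℝ), Continuous g →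
      ∫ y : S2, g (R y) ∂μ = ∫ y : S2, g y ∂μ)
    (k : ℕ) :
    (2 * k + 3) * sphereMoment μ (2 * (k + 1)) = (2 * k + 1) * sphereMoment μ (2 * k) := by
  have hmem (i : Fin 3) : EuclideanSpace.single i (1 : ℝ) ∈ Metric.sphere (0 : E3) 1 := by simp
  have hcoef : ((quadBivar ^ (k + 1)).coeff 2).eval 0 = (k + 1 : ℝ) := by
    have h1 : (quadBivar ^ (k + 1)).map (evalRingHom 0) = expand ℝ 2 ((1 + X) ^ (k + 1)) := by
      simp [quadBivar]
    have h2 := congrArg (fun p => coeff p 2) h1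
    have h3 := coeff_expand_mul (R := ℝ) (p := 2) (by norm_num) ((1 + X) ^ (k + 1)) 1
    rw [one_mul] at h3
    simp only [h3, coeff_map, coeff_one_add_X_pow] at h2
    simpa using h2
  have hchoose : ((2 * (k + 1)).choose 2 : ℝ) = (k + 1) * (2 * k + 1) := by
    rw [Nat.cast_choose_two]; push_cast; ring
  have hi (i : Fin 3) (hi0 : i ≠ 0) :
      (2 * k + 1) * ∫ y : S2, (y : E3) 0 ^ (2 * k) * (y : E3) i ^ 2 ∂μ
        = sphereMoment μ (2 * (k + 1)) := by
    have h := integral_inner_pow_mul_inner_pow hinv (k + 1) 2 (by omega) ⟨_, hmem 0⟩ ⟨_, hmem i⟩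
    have h0 : inner ℝ (EuclideanSpace.single (0 : Fin 3) (1 : ℝ))
        (EuclideanSpace.single i (1 : ℝ)) = 0 := by
      simp [EuclideanSpace.inner_single_left, hi0.symm]
    rw [hchoose, h0, hcoef] at h
    simp only [EuclideanSpace.inner_single_left, map_one, one_mul] at h
    have hk : (k + 1 : ℝ) ≠ 0 := by positivity
    refine mul_left_cancel₀ hk ?_
    rw [← mul_assoc, show 2 * k = 2 * (k + 1) - 2 by omega, h, mul_comm]
  have hsum : sphereMoment μ (2 * k) = sphereMoment μ (2 * (k + 1))
      + ∫ y : S2, (y : E3) 0 ^ (2 * k) * (y : E3) 1 ^ 2 ∂μ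
      + ∫ y : S2, (y : E3) 0 ^ (2 * k) * (y : E3) 2 ^ 2 ∂μ := by
    simp only [sphereMoment, EuclideanSpace.inner_single_left, map_one, one_mul]
    rw [← integral_add (integrable_of_continuous (by fun_prop))
        (integrable_of_continuous (by fun_prop)),
      ← integral_add (integrable_of_continuous (by fun_prop))
        (integrable_of_continuous (by fun_prop))]
    refine integral_congr_ae (Eventually.of_forall fun y => ?_)
    have hy : (y : E3) 0 ^ 2 + (y : E3) 1 ^ 2 + (y : E3) 2 ^ 2 = 1 := by
      have := EuclideanSpace.norm_sq_eq (y : E3)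
      rw [norm_eq_of_mem_sphere, Fin.sum_univ_three] at this
      simpa using this.symm
    linear_combination -(y : E3) 0 ^ (2 * k) * hy
  have h1 := hi 1 (by decide)
  have h2 := hi 2 (by decide)
  linear_combination -(2 * k + 1) * hsum - h1 - h2

lemma sphereMoment_even (hmass : μ.real Set.univ = 4 * Real.pi)
    (hinv : ∀ (R : E3 ≃ₗᵢ[ℝ] E3) (g : E3 → ℝ), Continuous g →
      ∫ y : S2, g (R y) ∂μ = ∫ y : S2, g y ∂μ)
    (k : ℕ) : sphereMoment μ (2 * k) = 4 * Real.pi / (2 * k + 1) := by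
  induction k with
  | zero => simp [sphereMoment, hmass]
  | succ k ih =>
    have h := sphereMoment_succ hinv k
    rw [ih, mul_div_cancel₀ _ (by positivity)] at h
    rw [eq_div_iff (by positivity)]
    push_cast
    linear_combination h

lemma integral_eval_inner (hmass : μ.real Set.univ = 4 * Real.pi)
    (hinv : ∀ (R : E3 ≃ₗᵢ[ℝ] E3) (g : E3 → ℝ), Continuous g →
      ∫ y : S2, g (R y) ∂μ = ∫ y : S2, g y ∂μ)
    (p : ℝ[X]) (x : S2) :
    ∫ y : S2, p.eval (inner ℝ (x : E3) (y : E3)) ∂μ = 2 * Real.pi * polyInt p := by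
  induction p using Polynomial.induction_on' with
  | add p q hp hq =>
    simp only [eval_add, map_add]
    rw [integral_add (integrable_of_continuous (by fun_prop))
      (integrable_of_continuous (by fun_prop)), hp, hq]
    ring
  | monomial n a =>
    simp only [eval_monomial, integral_const_mul]
    have hp : polyInt (monomial n a) = a * ((1 - (-1) ^ (n + 1)) / (n + 1)) := by
      simp [polyInt]
    rw [hp]
    rcases Nat.even_or_odd' n with ⟨k, rfl | rfl⟩
    · rw [integral_inner_pow_eq hinv, sphereMoment_even hmass hinv]
      simp [pow_succ, pow_mul]
      ring
    · have := integral_inner_pow_of_odd (a := 2 * k + 1) (b := 0) hinv (by simp) x x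
      simp only [pow_zero, mul_one] at this
      rw [this]
      simp [pow_succ, pow_mul]

lemma exists_convolution
    (hinv : ∀ (R : E3 ≃ₗᵢ[ℝ] E3) (g : E3 → ℝ), Continuous g →
      ∫ y : S2, g (R y) ∂μ = ∫ y : S2, g y ∂μ)
    (p q : ℝ[X]) :
    ∃ s : ℝ[X], s.natDegree ≤ q.natDegree ∧ ∀ x z : S2,
      ∫ y : S2, p.eval (inner ℝ (x : E3) (y : E3)) * q.eval (inner ℝ (z : E3) (y : E3)) ∂μ
        = s.eval (inner ℝ (x : E3) (z : E3)) := by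
  have hmon (a b : ℕ) : ∃ s : ℝ[X], s.natDegree ≤ b ∧ ∀ x z : S2,
      ∫ y : S2, inner ℝ (x : E3) (y : E3) ^ a * inner ℝ (z : E3) (y : E3) ^ b ∂μ
        = s.eval (inner ℝ (x : E3) (z : E3)) := by
    rcases Nat.even_or_odd (a + b) with h | h
    · obtain ⟨k, hk⟩ := h.two_dvd
      refine ⟨C (sphereMoment μ (2 * k) / (2 * k).choose b) * (quadBivar ^ k).coeff b,
        (natDegree_C_mul_le _ _).trans (natDegree_coeff_quadBivar_pow k b), fun x z => ?_⟩
      have h := integral_inner_pow_mul_inner_pow hinv k b (by omega) x z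
      have hpos : ((2 * k).choose b : ℝ) ≠ 0 := by
        exact_mod_cast (Nat.choose_pos (by omega)).ne'
      rw [show a = 2 * k - b by omega, eval_mul, eval_C, div_mul_eq_mul_div, eq_div_iff hpos, ← h]
      ring
    · exact ⟨0, by simp, fun x z => by simpa using integral_inner_pow_of_odd hinv h _ _⟩
  choose s hs hint using hmon
  refine ⟨∑ i ∈ Finset.range (p.natDegree + 1), ∑ j ∈ Finset.range (q.natDegree + 1),
    C (p.coeff i * q.coeff j) * s i j, ?_, fun x z => ?_⟩
  · refine natDegree_sum_le_of_forall_le _ _ fun i _ => natDegree_sum_le_of_forall_le _ _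
      fun j hj => (natDegree_C_mul_le _ _).trans ((hs i j).trans ?_)
    exact Nat.lt_succ_iff.mp (Finset.mem_range.mp hj)
  · simp only [eval_eq_sum_range (p := p), eval_eq_sum_range (p := q), Finset.sum_mul_sum]
    rw [integral_finsetSum _ fun i _ => integrable_of_continuous (by fun_prop),
      eval_finsetSum]
    refine Finset.sum_congr rfl fun i _ => ?_
    rw [integral_finsetSum _ fun i _ => integrable_of_continuous (by fun_prop),
      eval_finsetSum]
    refine Finset.sum_congr rfl fun j _ => ?_
    rw [eval_mul, eval_C, ← hint, ← integral_const_mul]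
    refine integral_congr_ae (Eventually.of_forall fun y => ?_)
    ring

/-- The reproducing property of the Legendre kernel on the sphere. -/
lemma integral_legendreP_mul_legendreP (hmass : μ.real Set.univ = 4 * Real.pi)
    (hinv : ∀ (R : E3 ≃ₗᵢ[ℝ] E3) (g : E3 → ℝ), Continuous g →
      ∫ y : S2, g (R y) ∂μ = ∫ y : S2, g y ∂μ)
    (l : ℕ) (x z : S2) :
    ∫ y : S2, (legendreP l).eval (inner ℝ (x : E3) (y : E3))
        * (legendreP l).eval (inner ℝ (z : E3) (y : E3)) ∂μ
      = 4 * Real.pi / (2 * l + 1) * (legendreP l).eval (inner ℝ (x : E3) (z : E3)) := by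
  obtain ⟨s, hs, hconv⟩ := exists_convolution hinv (legendreP l) (legendreP l)
  have hort : ∀ q : ℝ[X], q.degree < l → polyInt (s * q) = 0 := by
    intro q hq
    rcases eq_or_ne q 0 with rfl | hq0
    · simp
    obtain ⟨r, hr, hrconv⟩ := exists_convolution hinv (legendreP l) q
    have hrdeg : r.degree < l :=
      (degree_le_of_natDegree_le hr).trans_lt (by rwa [← degree_eq_natDegree hq0])
    have hswap : ∫ w : S2, (s * q).eval (inner ℝ (x : E3) (w : E3)) ∂μ
        = ∫ y : S2, (legendreP l * r).eval (inner ℝ (x : E3) (y : E3)) ∂μ := by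
      simp only [eval_mul, ← hconv, ← integral_mul_const]
      rw [integral_integral_swap]
      · refine integral_congr_ae (Eventually.of_forall fun y => ?_)
        simp only
        rw [real_inner_comm, ← hrconv, ← integral_const_mul]
        refine integral_congr_ae (Eventually.of_forall fun w => ?_)
        simp only
        rw [real_inner_comm (y : E3) (w : E3), real_inner_comm (x : E3) (y : E3)]
        ring
      · refine Continuous.integrable_of_hasCompactSupport ?_ (HasCompactSupport.of_compactSpace _)
        simp only [Function.uncurry_def]
        fun_prop
    rw [integral_eval_inner hmass hinv, integral_eval_inner hmass hinv,
      polyInt_legendreP_mul l r hrdeg] at hswap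
    simpa [Real.pi_ne_zero] using hswap
  have hs1 : s.eval 1 = 4 * Real.pi / (2 * l + 1) := by
    have h := hconv x x
    simp only [← eval_mul] at h
    rw [integral_eval_inner hmass hinv, polyInt_legendreP_mul_self, real_inner_self_eq_norm_sq,
      norm_eq_of_mem_sphere, one_pow] at h
    rw [← h]
    ring
  rw [hconv, eq_C_mul_legendreP (hs.trans (natDegree_legendreP_le l)) hort, hs1]
  simp

end Sphere

section Frame

variable {S H : Type*} [TopologicalSpace S] [NormedAddCommGroup H] [InnerProductSpace ℝ H]
  {T : S → H} {r : ℝ}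

lemma continuous_inner_of_mem_span (hcont : ∀ y, Continuous fun x => inner ℝ (T x) (T y)) {w : H}
    (hw : w ∈ Submodule.span ℝ (Set.range T)) : Continuous fun x => inner ℝ (T x) w := by
  induction hw using Submodule.span_induction with
  | mem w hw => obtain ⟨y, rfl⟩ := hw; exact hcont y
  | zero => simpa using continuous_const
  | add v w _ _ hv hw => simp only [inner_add_right]; exact hv.add hw
  | smul a w _ hw => simpa only [inner_smul_right] using hw.const_mul a

variable [CompactSpace S] [MeasurableSpace S] [BorelSpace S] {μ : Measure S} [IsFiniteMeasure μ]

lemma integral_inner_mul_inner_of_mem_span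
    (hcont : ∀ y, Continuous fun x => inner ℝ (T x) (T y))
    (hrep : ∀ x y, ∫ z, inner ℝ (T z) (T x) * inner ℝ (T z) (T y) ∂μ = r * inner ℝ (T x) (T y))
    {v w : H} (hv : v ∈ Submodule.span ℝ (Set.range T))
    (hw : w ∈ Submodule.span ℝ (Set.range T)) :
    ∫ z, inner ℝ (T z) v * inner ℝ (T z) w ∂μ = r * inner ℝ v w := by
  induction hv using Submodule.span_induction with
  | zero => simp
  | add v v' hv hv' ih ih' =>
    simp only [inner_add_right, inner_add_left, add_mul]
    rw [integral_add, ih, ih']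
    · ring
    all_goals
      exact integrable_of_continuous
        ((continuous_inner_of_mem_span hcont ‹_›).mul (continuous_inner_of_mem_span hcont hw))
  | smul a v hv ih =>
    simp only [inner_smul_right, real_inner_smul_left, mul_assoc, integral_const_mul, ih]
    ring
  | mem v hv =>
    obtain ⟨x, rfl⟩ := hv
    induction hw using Submodule.span_induction with
    | zero => simp
    | mem w hw => obtain ⟨y, rfl⟩ := hw; exact hrep x y
    | add w w' hw hw' ih ih' =>
      simp only [inner_add_right, mul_add]
      rw [integral_add, ih, ih']
      all_goals
        exact integrable_of_continuous
          ((hcont x).mul (continuous_inner_of_mem_span hcont ‹_›))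
    | smul a w hw ih =>
      simp only [inner_smul_right, mul_left_comm _ a, integral_const_mul, ih]

lemma mul_le_of_orthonormal
    (hcont : ∀ y, Continuous fun x => inner ℝ (T x) (T y)) (hnorm : ∀ x, ‖T x‖ = 1)
    (hrep : ∀ x y, ∫ z, inner ℝ (T z) (T x) * inner ℝ (T z) (T y) ∂μ = r * inner ℝ (T x) (T y))
    {m : ℕ} {v : Fin m → H} (hv : Orthonormal ℝ v)
    (hmem : ∀ i, v i ∈ Submodule.span ℝ (Set.range T)) :
    r * m ≤ μ.real Set.univ := by
  have hc : ∀ i, Continuous fun x => inner ℝ (T x) (v i) * inner ℝ (T x) (v i) := fun i =>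
    (continuous_inner_of_mem_span hcont (hmem i)).mul (continuous_inner_of_mem_span hcont (hmem i))
  have h1 : ∀ x, ∑ i, inner ℝ (T x) (v i) * inner ℝ (T x) (v i) ≤ 1 := by
    intro x
    have := hv.sum_inner_products_le (x := T x) (s := Finset.univ)
    simpa [hnorm, real_inner_comm, sq] using this
  have h2 := integral_mono (μ := μ)
    (integrable_of_continuous (continuous_finsetSum _ fun i _ => hc i))
    (integrable_const 1) h1
  rw [integral_finsetSum _ fun i _ => integrable_of_continuous (hc i)] at h2
  simp only [integral_inner_mul_inner_of_mem_span hcont hrep (hmem _) (hmem _),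
    real_inner_self_eq_norm_sq, hv.1] at h2
  simpa [mul_comm] using h2

/-- A family of unit vectors whose Gram kernel is `r` times a reproducing kernel spans a space
of finite dimension, equal to the total mass divided by `r`. -/
lemma exists_orthonormal_expansion
    (hcont : ∀ y, Continuous fun x => inner ℝ (T x) (T y)) (hnorm : ∀ x, ‖T x‖ = 1)
    (hrep : ∀ x y, ∫ z, inner ℝ (T z) (T x) * inner ℝ (T z) (T y) ∂μ = r * inner ℝ (T x) (T y))
    (hr : 0 < r) {n : ℕ} (hmass : μ.real Set.univ = r * n) :
    ∃ b : Fin n → H, Orthonormal ℝ b ∧ (∀ i, b i ∈ Submodule.span ℝ (Set.range T)) ∧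
      ∀ x, T x = ∑ i, inner ℝ (T x) (b i) • b i := by
  set W := Submodule.span ℝ (Set.range T) with hW
  have hfin : FiniteDimensional ℝ W := by
    by_contra hcon
    have hrank : ((n + 1 : ℕ) : Cardinal) ≤ Module.rank ℝ W :=
      (Cardinal.natCast_lt_aleph0).le.trans (not_lt.1 fun h => hcon (Module.rank_lt_aleph0_iff.1 h))
    obtain ⟨u, hu⟩ := exists_linearIndependent_of_le_rank hrank
    have ho := InnerProductSpace.gramSchmidtNormed_orthonormal hu
    have h := mul_le_of_orthonormal hcont hnorm hrep (ho.comp_linearIsometry W.subtypeₗᵢ)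
      (fun i => Subtype.property _)
    rw [hmass] at h
    have := le_of_mul_le_mul_left h hr
    push_cast at this
    linarith
  let b := stdOrthonormalBasis ℝ W
  have hb : Orthonormal ℝ fun i => (b i : H) := b.orthonormal.comp_linearIsometry W.subtypeₗᵢ
  have hexp : ∀ x, T x = ∑ i, inner ℝ (T x) (b i : H) • (b i : H) := by
    intro x
    have h := congrArg (Subtype.val) (b.sum_repr' ⟨T x, Submodule.subset_span ⟨x, rfl⟩⟩)
    simp only [Submodule.coe_sum, Submodule.coe_smul, Submodule.coe_inner] at h
    simpa only [real_inner_comm] using h.symm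
  have hc : ∀ i, Continuous fun x => inner ℝ (T x) (b i : H) * inner ℝ (T x) (b i : H) := fun i =>
    (continuous_inner_of_mem_span hcont (b i).2).mul (continuous_inner_of_mem_span hcont (b i).2)
  have hsum : ∀ x, ∑ i, inner ℝ (T x) (b i : H) * inner ℝ (T x) (b i : H) = 1 := by
    intro x
    have h := congrArg (fun y => inner ℝ (T x) y) (hexp x)
    simp only [inner_sum, inner_smul_right, real_inner_self_eq_norm_sq, hnorm] at h
    rw [← h, one_pow]
  have hint : r * n = r * Module.finrank ℝ W := by
    have h := integral_finsetSum (μ := μ) Finset.univ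
      fun i _ => integrable_of_continuous (hc i)
    simp only [hsum, integral_inner_mul_inner_of_mem_span hcont hrep (b _).2 (b _).2,
      real_inner_self_eq_norm_sq, hb.1] at h
    rw [← hmass]
    simpa [mul_comm] using h
  have hn : n = Module.finrank ℝ W := by exact_mod_cast mul_left_cancel₀ hr.ne' hint
  clear_value b
  clear_value W
  subst hn
  exact ⟨fun i => b i, hb, fun i => (b i).2, hexp⟩

end Frame

lemma integral_sq_gaussianReal : ∫ x, x ^ 2 ∂(gaussianReal 0 1) = 1 := by
  have h := variance_id_gaussianReal (μ := 0) (v := 1)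
  rw [variance_of_integral_eq_zero measurable_id.aemeasurable (by simp)] at h
  simpa using h

lemma integral_pow_four_gaussianReal : ∫ x, x ^ 4 ∂(gaussianReal 0 1) = 3 := by
  have h : ∫ x : ℝ, |x| ^ 4 * exp (-(1 / 2) * |x| ^ 2) = 3 * √(2 * π) := by
    rw [integral_comp_abs (f := fun x => x ^ 4 * exp (-(1 / 2) * x ^ 2))]
    have h := integral_rpow_mul_exp_neg_mul_rpow (p := 2) (q := 4) (b := 1 / 2) two_pos
      (by norm_num) (by norm_num)
    have hG : Gamma ((4 + 1) / 2) = 3 / 4 * √π := by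
      rw [show ((4 + 1) / 2 : ℝ) = 1 / 2 + 1 + 1 by norm_num, Gamma_add_one (by norm_num),
        Gamma_add_one (by norm_num), Gamma_one_half_eq]
      ring
    have hp : (1 / 2 : ℝ) ^ (-((4 : ℝ) + 1) / 2) = 4 * √2 := by
      rw [one_div, inv_rpow two_pos.le, ← rpow_neg two_pos.le, sqrt_eq_rpow,
        show (-(-((4 : ℝ) + 1) / 2)) = 2 + 1 / 2 by norm_num, rpow_add two_pos]
      norm_num
    rw [hG, hp] at h
    have e : ∀ x : ℝ, x ^ (4 : ℝ) * exp (-(1 / 2) * x ^ (2 : ℝ)) =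
      x ^ 4 * exp (-(1 / 2) * x ^ 2) := fun x => by norm_cast
    simp only [e] at h
    rw [h, sqrt_mul two_pos.le]
    ring
  rw [integral_gaussianReal_eq_integral_smul one_ne_zero]
  have e : ∀ x : ℝ, gaussianPDFReal 0 1 x • x ^ 4
      = (√(2 * π))⁻¹ * (|x| ^ 4 * exp (-(1 / 2) * |x| ^ 2)) := by
    intro x
    rw [sq_abs, Even.pow_abs (by decide), gaussianPDFReal, smul_eq_mul]
    have : -(x - 0) ^ 2 / (2 * ((1 : NNReal) : ℝ)) = -(1 / 2) * x ^ 2 := by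
      push_cast; ring
    rw [this]
    simp only [NNReal.coe_one, mul_one]
    ring
  simp only [e, integral_const_mul, h]
  have : √(2 * π) ≠ 0 := by positivity
  field_simp

section GaussianField

variable {S Ω : Type*} [MeasurableSpace Ω] {P : Measure Ω}
  {F : S → Ω → ℝ} {K : S → S → ℝ}

lemma map_eq_gaussianReal_one (hdiag : ∀ x, K x x = 1)
    (hG : ∀ (n : ℕ) (c : Fin n → ℝ) (x : Fin n → S), P.map (fun ω => ∑ i, c i * F (x i) ω) =
      gaussianReal 0 (∑ i, ∑ j, c i * c j * K (x i) (x j)).toNNReal) (x : S) :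
    P.map (F x) = gaussianReal 0 1 := by
  simpa [hdiag] using hG 1 (fun _ => 1) fun _ => x

lemma memLp_of_map_eq_gaussianReal {X : Ω → ℝ} (hX : AEMeasurable X P) {m : ℝ} {v : NNReal}
    (h : P.map X = gaussianReal m v) (p : NNReal) : MemLp X p P := by
  have := memLp_id_gaussianReal (μ := m) (v := v) p
  rw [← h] at this
  exact (memLp_map_measure_iff aestronglyMeasurable_id hX).1 this

lemma integral_sq_of_map_eq_gaussianReal {X : Ω → ℝ} (hX : AEMeasurable X P) {v : NNReal}
    (h : P.map X = gaussianReal 0 v) : ∫ ω, X ω ^ 2 ∂P = v := by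
  rw [← integral_map (f := fun x : ℝ => x ^ 2) hX (by fun_prop), h]
  have h := variance_id_gaussianReal (μ := 0) (v := v)
  rw [variance_of_integral_eq_zero measurable_id.aemeasurable (by simp)] at h
  simpa using h

lemma integral_mul_eq_kernel (hdiag : ∀ x, K x x = 1) (hsymm : ∀ x y, K x y = K y x)
    (hF : ∀ x, Measurable (F x))
    (hG : ∀ (n : ℕ) (c : Fin n → ℝ) (x : Fin n → S), P.map (fun ω => ∑ i, c i * F (x i) ω) =
      gaussianReal 0 (∑ i, ∑ j, c i * c j * K (x i) (x j)).toNNReal) (x y : S) :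
    ∫ ω, F x ω * F y ω ∂P = K x y := by
  have hlp : ∀ z, MemLp (F z) 2 P := fun z =>
    memLp_of_map_eq_gaussianReal (hF z).aemeasurable (map_eq_gaussianReal_one hdiag hG z) 2
  have hsq : ∀ z, ∫ ω, F z ω ^ 2 ∂P = 1 := fun z => by
    simpa using integral_sq_of_map_eq_gaussianReal (hF z).aemeasurable
      (map_eq_gaussianReal_one hdiag hG z)
  have key : ∀ s : ℝ, 1 + s ^ 2 + 2 * s * ∫ ω, F x ω * F y ω ∂P
      = max (1 + s ^ 2 + 2 * s * K x y) 0 := by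
    intro s
    have h := integral_sq_of_map_eq_gaussianReal (by fun_prop) (hG 2 ![1, s] ![x, y])
    simp only [Fin.sum_univ_two, Matrix.cons_val_zero, Matrix.cons_val_one, hdiag,
      hsymm y x, Real.coe_toNNReal', one_mul, mul_one] at h
    have e : ∀ ω, (F x ω + s * F y ω) ^ 2
        = F x ω ^ 2 + (s ^ 2 * F y ω ^ 2 + 2 * s * (F x ω * F y ω)) := fun ω => by ring
    simp only [e] at h
    have i1 := (hlp x).integrable_sq
    have i2 := (hlp y).integrable_sq
    have i3 : Integrable (fun ω => F x ω * F y ω) P := (hlp x).integrable_mul (hlp y)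
    rw [integral_add i1 (by fun_prop), integral_add (by fun_prop) (by fun_prop),
      integral_const_mul, integral_const_mul, hsq, hsq] at h
    rw [show 1 + s ^ 2 + 2 * s * K x y = 1 + s * K x y + (s * K x y + s * s) by ring, ← h]
    ring
  have h1 := key 1
  have h2 := key (-1)
  rcases max_cases (1 + 1 ^ 2 + 2 * 1 * K x y) 0 with h | h <;>
  rcases max_cases (1 + (-1) ^ 2 + 2 * (-1) * K x y) 0 with h' | h' <;> linarith

lemma exists_hilbert_embedding (hdiag : ∀ x, K x x = 1) (hsymm : ∀ x y, K x y = K y x)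
    (hF : ∀ x, Measurable (F x))
    (hG : ∀ (n : ℕ) (c : Fin n → ℝ) (x : Fin n → S), P.map (fun ω => ∑ i, c i * F (x i) ω) =
      gaussianReal 0 (∑ i, ∑ j, c i * c j * K (x i) (x j)).toNNReal) :
    ∃ T : S → Lp ℝ 2 P, (∀ x, T x =ᵐ[P] F x) ∧ (∀ x y, inner ℝ (T x) (T y) = K x y) ∧
      ∀ w ∈ Submodule.span ℝ (Set.range T), P.map w = gaussianReal 0 (‖w‖₊ ^ 2) := by
  have hlp : ∀ z, MemLp (F z) 2 P := fun z =>
    memLp_of_map_eq_gaussianReal (hF z).aemeasurable (map_eq_gaussianReal_one hdiag hG z) 2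
  have hT : ∀ x, (hlp x).toLp =ᵐ[P] F x := fun x => (hlp x).coeFn_toLp
  have hK : ∀ x y, inner ℝ (hlp x).toLp (hlp y).toLp = K x y := by
    intro x y
    rw [L2.inner_def, ← integral_mul_eq_kernel hdiag hsymm hF hG x y]
    refine integral_congr_ae ?_
    filter_upwards [hT x, hT y] with ω hx hy
    rw [hx, hy]
    simp [mul_comm]
  refine ⟨fun x => (hlp x).toLp, hT, hK, fun w hw => ?_⟩
  obtain ⟨n, c, g, rfl⟩ := Submodule.mem_span_set'.1 hw
  choose x hx using fun i => (g i).2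
  simp only [← hx]
  have hae : (∑ i, c i • (hlp (x i)).toLp : Lp ℝ 2 P) =ᵐ[P] fun ω => ∑ i, c i * F (x i) ω := by
    refine (Lp.coeFn_finsetSum _ _).trans ?_
    have := fun i => Lp.coeFn_smul (c i) (hlp (x i)).toLp
    filter_upwards [ae_all_iff.2 this, ae_all_iff.2 fun i => hT (x i)] with ω h1 h2
    simp [h1, h2]
  rw [Measure.map_congr hae, hG]
  congr 1
  rw [← NNReal.coe_inj, NNReal.coe_pow, coe_nnnorm, ← real_inner_self_eq_norm_sq,
    Real.coe_toNNReal']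
  have : inner ℝ (∑ i, c i • (hlp (x i)).toLp) (∑ i, c i • (hlp (x i)).toLp)
      = ∑ i, ∑ j, c i * c j * K (x i) (x j) := by
    simp only [sum_inner, inner_sum, real_inner_smul_left, inner_smul_right, hK, mul_assoc,
      Finset.mul_sum, hsymm]
  rw [← this]
  exact max_eq_left real_inner_self_nonneg

lemma iIndepFun_of_orthonormal [IsProbabilityMeasure P] {n : ℕ} {b : Fin n → Lp ℝ 2 P} (hb : Orthonormal ℝ b)
    (hlaw : ∀ w ∈ Submodule.span ℝ (Set.range b), P.map w = gaussianReal 0 (‖w‖₊ ^ 2)) :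
    iIndepFun (fun i => (b i : Ω → ℝ)) P := by
  have hm : ∀ i, Measurable (b i) := fun i => (Lp.stronglyMeasurable (b i)).measurable
  rw [iIndepFun_iff_charFun_pi fun i => (hm i).aemeasurable]
  intro t
  have hmem : ∑ i, t i • b i ∈ Submodule.span ℝ (Set.range b) :=
    Submodule.sum_mem _ fun i _ => Submodule.smul_mem _ _ (Submodule.subset_span ⟨i, rfl⟩)
  have hnorm : ‖∑ i, t i • b i‖ ^ 2 = ∑ i, t i ^ 2 := by
    rw [← real_inner_self_eq_norm_sq, hb.inner_sum]
    simp [sq]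
  have hae : (∑ i, t i • b i : Lp ℝ 2 P) =ᵐ[P] fun ω => ∑ i, t i * b i ω := by
    refine (Lp.coeFn_finsetSum _ _).trans ?_
    filter_upwards [ae_all_iff.2 fun i => Lp.coeFn_smul (t i) (b i)] with ω h
    simp [h]
  have h1 : ∀ i, P.map (b i) = gaussianReal 0 1 := fun i => by
    have : ‖b i‖₊ = 1 := NNReal.eq (hb.1 i)
    rw [hlaw _ (Submodule.subset_span ⟨i, rfl⟩), this, one_pow]
  have h2 : charFun (P.map (fun ω => WithLp.toLp 2 fun i => b i ω)) t
      = charFun (P.map (∑ i, t i • b i : Lp ℝ 2 P)) 1 := by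
    rw [Measure.map_congr hae, charFun_apply_real, charFun_apply,
      integral_map (by fun_prop) (by fun_prop), integral_map (by fun_prop) (by fun_prop)]
    simp [PiLp.inner_apply]
  simp only [h2, hlaw _ hmem, h1, charFun_gaussianReal, ← Complex.exp_sum]
  congr 1
  have h3 := congrArg (fun x : ℝ => (x : ℂ)) hnorm
  push_cast at h3
  simp [h3, Finset.sum_div]

end GaussianField

section Chaos

variable {S Ω : Type*} [TopologicalSpace S] [CompactSpace S] [MeasurableSpace S] [BorelSpace S]
  [MeasurableSpace Ω] {μ : Measure S} [IsFiniteMeasure μ] {P : Measure Ω} [IsProbabilityMeasure P]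
  {F : S → Ω → ℝ} {K : S → S → ℝ} {r : ℝ} {n : ℕ}

lemma exists_iIndepFun_integral_sq_eq (hdiag : ∀ x, K x x = 1) (hsymm : ∀ x y, K x y = K y x)
    (hcont : ∀ y, Continuous fun x => K x y)
    (hrep : ∀ x y, ∫ z, K z x * K z y ∂μ = r * K x y)
    (hr : 0 < r) (hmass : μ.real Set.univ = r * n)
    (hF : Measurable (Function.uncurry F))
    (hG : ∀ (n : ℕ) (c : Fin n → ℝ) (x : Fin n → S), P.map (fun ω => ∑ i, c i * F (x i) ω) =
      gaussianReal 0 (∑ i, ∑ j, c i * c j * K (x i) (x j)).toNNReal) :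
    ∃ ξ : Fin n → Ω → ℝ, (∀ i, Measurable (ξ i)) ∧ iIndepFun ξ P ∧
      (∀ i, P.map (ξ i) = gaussianReal 0 1) ∧
      ∀ᵐ ω ∂P, ∫ x, (F x ω ^ 2 - 1) ∂μ = r * ∑ i, (ξ i ω ^ 2 - 1) := by
  obtain ⟨T, hT, hK, hlaw⟩ := exists_hilbert_embedding (P := P) (F := F) hdiag hsymm
    (fun x => hF.of_uncurry_left) hG
  simp only [← hK] at hcont hrep
  have hnorm : ∀ x, ‖T x‖ = 1 := fun x => by
    rw [← sq_eq_sq₀ (norm_nonneg _) zero_le_one, ← real_inner_self_eq_norm_sq, hK, hdiag, one_pow]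
  obtain ⟨b, hb, hmem, hexp⟩ := exists_orthonormal_expansion hcont hnorm hrep hr hmass
  have hm : ∀ i, Measurable (b i) := fun i => (Lp.stronglyMeasurable (b i)).measurable
  have hc : ∀ i, Continuous fun x => inner ℝ (T x) (b i) :=
    fun i => continuous_inner_of_mem_span hcont (hmem i)
  refine ⟨fun i => b i, hm, iIndepFun_of_orthonormal hb fun w hw => hlaw w ?_, fun i => ?_, ?_⟩
  · exact Submodule.span_le.2 (Set.range_subset_iff.2 hmem) hw
  · have : ‖b i‖₊ = 1 := NNReal.eq (hb.1 i)
    rw [hlaw _ (hmem i), this, one_pow]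
  have hae : ∀ᵐ ω ∂P, ∀ᵐ x ∂μ, F x ω = ∑ i, inner ℝ (T x) (b i) * b i ω := by
    refine (Measure.ae_ae_comm ?_).1 (ae_of_all _ fun x => ?_)
    · refine measurableSet_eq_fun hF (Finset.measurable_fun_sum _ fun i _ => ?_)
      exact ((hc i).measurable.comp measurable_fst).mul ((hm i).comp measurable_snd)
    · have h1 := Lp.coeFn_finsetSum Finset.univ fun i => inner ℝ (T x) (b i) • b i
      rw [← hexp x] at h1
      filter_upwards [hT x, h1, ae_all_iff.2 fun i => Lp.coeFn_smul (inner ℝ (T x) (b i)) (b i)]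
        with ω h2 h3 h4
      rw [← h2, h3]
      simp [h4]
  filter_upwards [hae] with ω hω
  have hi : ∀ i j, Integrable (fun x => b i ω * b j ω * (inner ℝ (T x) (b i) * inner ℝ (T x) (b j)))
      μ := fun i j => (integrable_of_continuous ((hc i).mul (hc j))).const_mul _
  have e : ∀ᵐ x ∂μ, F x ω ^ 2 - 1
      = ∑ i, ∑ j, b i ω * b j ω * (inner ℝ (T x) (b i) * inner ℝ (T x) (b j)) - 1 := by
    filter_upwards [hω] with x hx
    rw [hx, sq, Finset.sum_mul_sum]
    congr 1
    exact Finset.sum_congr rfl fun i _ => Finset.sum_congr rfl fun j _ => by ring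
  rw [integral_congr_ae e, integral_sub
    (integrable_finsetSum _ fun i _ => integrable_finsetSum _ fun j _ => hi i j)
    (integrable_const 1), integral_finsetSum _ fun i _ => integrable_finsetSum _ fun j _ => hi i j]
  simp only [integral_finsetSum _ fun j _ => hi _ j, integral_const_mul,
    integral_inner_mul_inner_of_mem_span hcont hrep (hmem _) (hmem _),
    orthonormal_iff_ite.1 hb, integral_const, hmass]
  simp [Finset.mul_sum, mul_sub, sq, mul_comm]

end Chaos

section ChiSquare

variable {Ω : Type*} [MeasurableSpace Ω] {P : Measure Ω}

/-- The centred square of a standard Gaussian, normalized to unit variance. -/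
noncomputable def normSq (x : ℝ) : ℝ := (√2)⁻¹ * (x ^ 2 - 1)

@[fun_prop]
lemma continuous_normSq : Continuous normSq := by unfold normSq; fun_prop

lemma integrable_pow_gaussianReal (k : ℕ) : Integrable (fun x : ℝ => x ^ k) (gaussianReal 0 1) :=
  (integrable_norm_iff (by fun_prop)).1 <| by
    simpa using (memLp_id_gaussianReal (μ := 0) (v := 1) k).integrable_norm_pow'

lemma integral_normSq_gaussianReal : ∫ x, normSq x ∂(gaussianReal 0 1) = 0 := by
  simp only [normSq]
  rw [integral_const_mul, integral_sub (integrable_pow_gaussianReal 2) (integrable_const 1),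
    integral_sq_gaussianReal]
  simp

lemma integral_normSq_sq_gaussianReal : ∫ x, normSq x ^ 2 ∂(gaussianReal 0 1) = 1 := by
  have e : ∀ x, normSq x ^ 2 = 2⁻¹ * (x ^ 4 - 2 * x ^ 2 + 1) := fun x => by
    rw [normSq, mul_pow, inv_pow, sq_sqrt two_pos.le]
    ring
  have i2 := integrable_pow_gaussianReal 2
  have i4 := integrable_pow_gaussianReal 4
  simp only [e]
  rw [integral_const_mul, integral_add (by fun_prop) (by fun_prop),
    integral_sub (by fun_prop) (by fun_prop), integral_const_mul, integral_sq_gaussianReal,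
    integral_pow_four_gaussianReal]
  norm_num

lemma memLp_normSq_gaussianReal : MemLp normSq 2 (gaussianReal 0 1) := by
  rw [memLp_two_iff_integrable_sq (by fun_prop)]
  by_contra h
  simpa [integral_undef h] using integral_normSq_sq_gaussianReal

variable {n : ℕ} {ξ : Fin n → Ω → ℝ}

lemma integral_sum_normSq_sq [IsProbabilityMeasure P] (hm : ∀ i, Measurable (ξ i)) (hind : iIndepFun ξ P)
    (hlaw : ∀ i, P.map (ξ i) = gaussianReal 0 1) :
    ∫ ω, (∑ i, normSq (ξ i ω)) ^ 2 ∂P = n := by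
  have hlp : ∀ i, MemLp (fun ω => normSq (ξ i ω)) 2 P := fun i =>
    (memLp_map_measure_iff (g := normSq) (by fun_prop) (hm i).aemeasurable).1
      ((hlaw i).symm ▸ memLp_normSq_gaussianReal)
  have h0 : ∀ i, ∫ ω, normSq (ξ i ω) ∂P = 0 := fun i => by
    rw [← integral_map (hm i).aemeasurable (by fun_prop), hlaw, integral_normSq_gaussianReal]
  have h1 : ∀ i, Var[fun ω => normSq (ξ i ω); P] = 1 := fun i => by
    rw [variance_of_integral_eq_zero (hlp i).aemeasurable (h0 i),
      ← integral_map (f := fun x => normSq x ^ 2) (hm i).aemeasurable (by fun_prop), hlaw,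
      integral_normSq_sq_gaussianReal]
  have hv := IndepFun.variance_sum (s := Finset.univ) (fun i _ => hlp i) (fun i _ j _ hij =>
    (hind.indepFun hij).comp continuous_normSq.measurable continuous_normSq.measurable)
  rw [variance_of_integral_eq_zero] at hv
  · simpa [h1] using hv
  · exact Finset.aemeasurable_sum _ fun i _ => (hlp i).aemeasurable
  · simp only [Finset.sum_apply]
    rw [integral_finsetSum _ fun i _ => (hlp i).integrable one_le_two]
    simp [h0]

lemma charFun_sum_normSq (hm : ∀ i, Measurable (ξ i)) (hind : iIndepFun ξ P)
    (hlaw : ∀ i, P.map (ξ i) = gaussianReal 0 1) (c t : ℝ) :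
    charFun (P.map fun ω => c * ∑ i, normSq (ξ i ω)) t
      = charFun ((gaussianReal 0 1).map normSq) (c * t) ^ n := by
  have h := (hind.comp (fun _ => normSq) fun _ => continuous_normSq.measurable)
    |>.charFun_map_fun_sum_eq_prod fun i => (continuous_normSq.measurable.comp (hm i)).aemeasurable
  have h1 : ∀ i, P.map (normSq ∘ ξ i) = (gaussianReal 0 1).map normSq := fun i => by
    rw [← hlaw i, Measure.map_map continuous_normSq.measurable (hm i)]
  have hs : AEMeasurable (fun ω => ∑ i, normSq (ξ i ω)) P := by fun_prop
  rw [charFun_map_mul_comp hs]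
  simp only [h1, Function.comp_apply] at h
  rw [h]
  simp

lemma tendstoInDistribution_mul_sum_normSq [IsProbabilityMeasure P] {N : ℕ → ℕ}
    (hN : Tendsto N atTop atTop) {ξ : (l : ℕ) → Fin (N l) → Ω → ℝ} (hm : ∀ l i, Measurable (ξ l i))
    (hind : ∀ l, iIndepFun (ξ l) P) (hlaw : ∀ l i, P.map (ξ l i) = gaussianReal 0 1) {c : ℕ → ℝ}
    (hc : Tendsto (fun l => c l * √(N l)) atTop (nhds 1)) :
    TendstoInDistribution (fun l ω => c l * ∑ i, normSq (ξ l i ω)) atTop id (fun _ => P)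
      (gaussianReal 0 1) := by
  have hW : TendstoInDistribution (fun l ω => (√(N l))⁻¹ * ∑ i, normSq (ξ l i ω)) atTop id
      (fun _ => P) (gaussianReal 0 1) := by
    refine ⟨fun l => by fun_prop, aemeasurable_id, ?_⟩
    refine ProbabilityMeasure.tendsto_iff_tendsto_charFun.2 fun t => ?_
    have h := (tendsto_charFun_inv_sqrt_mul_pow (P := gaussianReal 0 1) (X := normSq)
      (by fun_prop) integral_normSq_gaussianReal integral_normSq_sq_gaussianReal t).comp hN
    simpa [charFun_sum_normSq (hm _) (hind _) (hlaw _), charFun_gaussianReal, neg_div,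
      Function.comp_def] using h
  have hY : TendstoInMeasure P (fun l _ => c l * √(N l)) atTop (fun _ => (1 : ℝ)) :=
    tendstoInMeasure_of_tendsto_ae (fun l => aestronglyMeasurable_const) (ae_of_all _ fun _ => hc)
  refine (hW.continuous_comp_prodMk_of_tendstoInMeasure_const (g := fun p : ℝ × ℝ => p.1 * p.2)
    (by fun_prop) hY fun l => aemeasurable_const).congr (fun l => ae_of_all _ fun ω => ?_)
    (ae_of_all _ fun x => by simp)
  rcases Nat.eq_zero_or_pos (N l) with h0 | h0
  · have : IsEmpty (Fin (N l)) := by rw [h0]; infer_instance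
    simp
  · have : √(N l : ℝ) ≠ 0 := by positivity
    field_simp

end ChiSquare

end LegendreCLT


/-- with `Z_l = √l · ∫_{S²}(f_l² - 1)` for the centered isotropic Gaussian
field `f_l` with covariance `P_l(⟨x,y⟩)`, one has `E[Z_l²] = 2l(4π)²/(2l+1)` and
`Z_l/(4π)` converges in distribution to a standard Gaussian (fourth-moment theorem). -/
theorem clt_second_chaos
    (μ : Measure S2) [IsFiniteMeasure μ]
    (hμ : μ Set.univ = ENNReal.ofReal (4 * Real.pi))
    (hrot : ∀ R : E3 ≃ₗᵢ[ℝ] E3,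
      Measure.map
        (fun y : S2 => (⟨R y, by
          simp only [mem_sphere_zero_iff_norm, R.norm_map]
          exact mem_sphere_zero_iff_norm.mp y.2⟩ : S2)) μ = μ)
    {Ω : Type*} [MeasureSpace Ω] [IsProbabilityMeasure (volume : Measure Ω)]
    (f : ℕ → S2 → Ω → ℝ)
    (hmeas : ∀ l : ℕ, Measurable (Function.uncurry (f l)))
    (hGauss : ∀ (l n : ℕ) (c : Fin n → ℝ) (x : Fin n → S2),
      Measure.map (fun ω => ∑ i, c i * f l (x i) ω) volume =
        gaussianReal 0 (Real.toNNReal (∑ i, ∑ j, c i * c j *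
          (legendreP l).eval (@inner ℝ E3 _ (x i : E3) (x j : E3)))))
    (Z : ℕ → Ω → ℝ)
    (hZ : ∀ l : ℕ, Z l = fun ω => Real.sqrt l * ∫ x, ((f l x ω) ^ 2 - 1) ∂μ) :
    (∀ l : ℕ, (∫ ω, (Z l ω) ^ 2) = 2 * (l : ℝ) * (4 * Real.pi) ^ 2 / (2 * (l : ℝ) + 1)) ∧
    (∀ g : BoundedContinuousFunction ℝ ℝ,
      Tendsto (fun l : ℕ => ∫ ω, g (Z l ω / (4 * Real.pi))) atTop
        (nhds (∫ x : ℝ, g x ∂(gaussianReal 0 1)))) := by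
  have hmass : μ.real Set.univ = 4 * Real.pi := by
    rw [Measure.real, hμ, ENNReal.toReal_ofReal (by positivity)]
  have hinv : ∀ (R : E3 ≃ₗᵢ[ℝ] E3) (g : E3 → ℝ), Continuous g →
      ∫ y : S2, g (R y) ∂μ = ∫ y : S2, g y ∂μ := by
    intro R g hg
    conv_rhs => rw [← hrot R]
    rw [integral_map]
    · exact (Continuous.subtype_mk (by fun_prop) _).measurable.aemeasurable
    · exact (hg.comp continuous_subtype_val).aestronglyMeasurable
  have hstruct := fun l : ℕ => LegendreCLT.exists_iIndepFun_integral_sq_eq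
    (μ := μ) (P := (volume : Measure Ω)) (F := f l) (r := 4 * Real.pi / (2 * l + 1))
    (n := 2 * l + 1)
    (K := fun x y => (legendreP l).eval (@inner ℝ E3 _ (x : E3) (y : E3)))
    (fun x => by
      rw [real_inner_self_eq_norm_sq, norm_eq_of_mem_sphere, one_pow,
        LegendreCLT.legendreP_eval_one])
    (fun x y => by rw [real_inner_comm])
    (fun y => by fun_prop)
    (fun x y => by
      rw [← LegendreCLT.integral_legendreP_mul_legendreP hmass hinv]
      simp only [real_inner_comm])
    (by positivity) (by rw [hmass]; push_cast; field_simp)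
    (hmeas l) (hGauss l)
  choose ξ hm hind hlaw hae using hstruct
  have hZae : ∀ l, Z l =ᵐ[volume] fun ω =>
      √l * (4 * Real.pi / (2 * l + 1)) * √2 * ∑ i, LegendreCLT.normSq (ξ l i ω) := by
    intro l
    filter_upwards [hae l] with ω hω
    have : √2 * (√2)⁻¹ = (1 : ℝ) := mul_inv_cancel₀ (by positivity)
    simp only [hZ, hω, LegendreCLT.normSq, ← Finset.mul_sum]
    linear_combination (-√l * (4 * Real.pi / (2 * l + 1)) * ∑ i, (ξ l i ω ^ 2 - 1)) * this
  refine ⟨fun l => ?_, fun g => ?_⟩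
  · have e : ∀ᵐ ω, Z l ω ^ 2 = 2 * l * (4 * Real.pi / (2 * l + 1)) ^ 2
        * (∑ i, LegendreCLT.normSq (ξ l i ω)) ^ 2 := by
      filter_upwards [hZae l] with ω hω
      rw [hω, mul_pow, mul_pow, mul_pow, sq_sqrt (Nat.cast_nonneg l), sq_sqrt two_pos.le]
      ring
    rw [integral_congr_ae e, integral_const_mul,
      LegendreCLT.integral_sum_normSq_sq (hm l) (hind l) (hlaw l)]
    push_cast
    field_simp
  · have hN : Tendsto (fun l : ℕ => 2 * l + 1) atTop atTop :=
      tendsto_atTop_mono (fun l => show l ≤ 2 * l + 1 by omega) tendsto_id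
    have hlim : Tendsto (fun l : ℕ => √l * √2 / (2 * l + 1) * √((2 * l + 1 : ℕ) : ℝ)) atTop
        (nhds 1) := by
      have h1 : Tendsto (fun l : ℕ => √(1 - ((2 * l + 1 : ℕ) : ℝ)⁻¹)) atTop (nhds √(1 - 0)) :=
        ((tendsto_inv_atTop_nhds_zero_nat.comp hN).const_sub 1).sqrt
      rw [sub_zero, sqrt_one] at h1
      refine h1.congr fun l => ?_
      have hpos : (0 : ℝ) < 2 * l + 1 := by positivity
      have e : 1 - ((2 * l + 1 : ℕ) : ℝ)⁻¹ = l * 2 / (2 * l + 1) := by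
        push_cast
        field_simp
        ring
      rw [e, sqrt_div (by positivity), sqrt_mul (Nat.cast_nonneg l)]
      push_cast
      have h2 := mul_self_sqrt hpos.le
      field_simp
      rw [sq, h2]
    have hdist := LegendreCLT.tendstoInDistribution_mul_sum_normSq hN hm hind hlaw hlim
    have h := ProbabilityMeasure.tendsto_iff_forall_integral_tendsto.1 hdist.tendsto g
    simp only [ProbabilityMeasure.coe_mk, Measure.map_id] at h
    refine h.congr fun l => ?_
    rw [integral_map (hdist.forall_aemeasurable l) (by fun_prop)]
    refine integral_congr_ae ?_
    filter_upwards [hZae l] with ω hω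
    rw [hω]
    congr 1
    field_simp
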